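/- (BEST theorem) Let G be a connected directed multigraph in which every vertex has equal in- and out-degree, with a marked edge e_0 and a vertex w_0. Then the number of Eulerian cycles of G starting with the edge e_0 equals T(G, w_0) ⋅ Π_{v ∈ V} (outdeg(v) - 1)!, where T(G, w_0) is the number of spanning trees of G oriented towards w_0. In particular T(G, w_0) is independent of the choice of w_0. -/

import Mathlib

open scoped Classical BigOperators

noncomputable section

/-- Out-degree of a vertex in a directed multigraph given by source/target maps. -/
noncomputable def outdeg {V E : Type*} [Fintype E] (src _tgt : E → V) (v : V) : ℕ :=
  (Finset.univ.filter (fun e => src e = v)).card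

/-- In-degree of a vertex in a directed multigraph. -/
noncomputable def indeg {V E : Type*} [Fintype E] (_src tgt : E → V) (v : V) : ℕ :=
  (Finset.univ.filter (fun e => tgt e = v)).card

/-- `T` is a spanning tree (arborescence) oriented towards `w0`: every vertex other
than `w0` has exactly one outgoing edge in `T`, `w0` has none, and every vertex
reaches `w0` along edges of `T`. -/
def IsArborescence {V E : Type*} (src tgt : E → V) (T : Finset E) (w0 : V) : Prop :=
  (∀ v, v ≠ w0 → ∃! e, e ∈ T ∧ src e = v) ∧ (∀ e ∈ T, src e ≠ w0) ∧
    ∀ v, Relation.ReflTransGen (fun a b => ∃ e ∈ T, src e = a ∧ tgt e = b) v w0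

/-- The number `T(G, w0)` of arborescences of `G` oriented towards `w0`. -/
noncomputable def treeCount {V E : Type*} [Fintype E] (src tgt : E → V) (w0 : V) : ℕ :=
  Nat.card {T : Finset E // IsArborescence src tgt T w0}

section BEST

variable {V E : Type*}

/-- `l` is the edge sequence of a walk from the first vertex to the second one. -/
def IsEdgeWalk (src tgt : E → V) : V → List E → V → Prop
  | u, [], w => u = w
  | u, e :: l, w => src e = u ∧ IsEdgeWalk src tgt (tgt e) l w

/-- `T` is an arborescence towards `w` in the subgraph with edge set `S`, spanning the vertices
with an outgoing edge in `S`. -/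
def IsArborescenceOn (src tgt : E → V) (S T : Finset E) (w : V) : Prop :=
  T ⊆ S ∧ (∀ v, v ≠ w → (∃ e ∈ S, src e = v) → ∃! e, e ∈ T ∧ src e = v) ∧
    (∀ e ∈ T, src e ≠ w) ∧
    ∀ v, (∃ e ∈ S, src e = v) →
      Relation.ReflTransGen (fun a b => ∃ e ∈ T, src e = a ∧ tgt e = b) v w

/-- Number of arborescences towards `w` in the subgraph with edge set `S`. -/
def treeCountOn [Fintype E] (src tgt : E → V) (S : Finset E) (w : V) : ℕ :=
  (Finset.univ.filter fun T => IsArborescenceOn src tgt S T w).card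

/-- Walks from `u` to `w` using every edge of `S` exactly once and no other edge. -/
abbrev EulerTrail (src tgt : E → V) (S : Finset E) (u w : V) : Type _ :=
  {l : List E // IsEdgeWalk src tgt u l w ∧ l.Nodup ∧ ∀ e, e ∈ l ↔ e ∈ S}

instance [Fintype E] (src tgt : E → V) (S : Finset E) (u w : V) :
    Finite (EulerTrail src tgt S u w) :=
  Finite.of_injective (β := {l : List E // l.Nodup}) (fun l => ⟨l.1, l.2.2.1⟩)
    fun a b h => Subtype.ext (by simpa using h)

theorem card_filter_erase_add {α : Type*} (p : α → Prop) (S : Finset α) {a : α} (ha : a ∈ S) :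
    ((S.erase a).filter p).card + (if p a then 1 else 0) = (S.filter p).card := by
  conv_rhs => rw [← Finset.insert_erase ha, Finset.filter_insert]
  split_ifs with h
  · rw [Finset.card_insert_of_notMem (by simp)]
  · simp

/-- Splitting off the first edge of an Eulerian trail. -/
def eulerTrailEquiv (src tgt : E → V) (S : Finset E) (u w : V) (hS : S.Nonempty) :
    EulerTrail src tgt S u w ≃
      Σ e : {e // e ∈ S.filter (src · = u)}, EulerTrail src tgt (S.erase e) (tgt e) w where
  toFun
    | ⟨[], h⟩ => absurd hS (by
        rintro ⟨e, he⟩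
        simpa using (h.2.2 e).2 he)
    | ⟨e :: l, h⟩ => ⟨⟨e, by
        have h1 := (h.2.2 e).1 (by simp)
        have h2 := h.1.1
        simp [h1, h2]⟩, ⟨l, h.1.2, (List.nodup_cons.1 h.2.1).2, fun x => by
          have h1 := h.2.2 x
          have h2 := (List.nodup_cons.1 h.2.1).1
          simp only [List.mem_cons] at h1
          simp only [Finset.mem_erase, ← h1]
          grind⟩⟩
  invFun x := ⟨x.1.1 :: x.2.1, by
    obtain ⟨⟨e, he⟩, ⟨l, hw, hn, hm⟩⟩ := x
    have he' := Finset.mem_filter.1 he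
    refine ⟨⟨he'.2, hw⟩, List.nodup_cons.2 ⟨by simp [hm], hn⟩, fun x => ?_⟩
    simp only [List.mem_cons, hm, Finset.mem_erase]
    grind⟩
  left_inv := by
    rintro ⟨l, h⟩
    cases l with
    | nil =>
      obtain ⟨e, he⟩ := hS
      exact absurd ((h.2.2 e).2 he) (by simp)
    | cons e l => rfl
  right_inv := by
    rintro ⟨⟨e, he⟩, ⟨l, h⟩⟩
    rfl

theorem card_eulerTrail [Fintype E] (src tgt : E → V) (S : Finset E) (u w : V)
    (hS : S.Nonempty) :
    Nat.card (EulerTrail src tgt S u w) =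
      ∑ e ∈ S.filter (src · = u), Nat.card (EulerTrail src tgt (S.erase e) (tgt e) w) := by
  rw [Nat.card_congr (eulerTrailEquiv src tgt S u w hS), Nat.card_sigma]
  exact Finset.sum_coe_sort (S.filter (src · = u))
    (fun e => Nat.card (EulerTrail src tgt (S.erase e) (tgt e) w))

theorem isArborescenceOn_erase_of_src_eq {src tgt : E → V} {S T : Finset E} {w : V} {e : E}
    (he : src e = w) :
    IsArborescenceOn src tgt (S.erase e) T w ↔ IsArborescenceOn src tgt S T w := by
  have hv : ∀ v, v ≠ w → ((∃ x ∈ S.erase e, src x = v) ↔ ∃ x ∈ S, src x = v) := by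
    intro v hv
    refine ⟨fun ⟨x, hx, h⟩ => ⟨x, Finset.mem_of_mem_erase hx, h⟩, fun ⟨x, hx, h⟩ => ⟨x, ?_, h⟩⟩
    exact Finset.mem_erase.2 ⟨by grind, hx⟩
  constructor
  · rintro ⟨h1, h2, h3, h4⟩
    refine ⟨h1.trans (Finset.erase_subset _ _), fun v hvw h => h2 v hvw ((hv v hvw).2 h), h3,
      fun v h => ?_⟩
    by_cases hvw : v = w
    · exact hvw ▸ .refl
    · exact h4 v ((hv v hvw).2 h)
  · rintro ⟨h1, h2, h3, h4⟩
    refine ⟨Finset.subset_erase.2 ⟨h1, fun h => h3 e h he⟩,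
      fun v hvw h => h2 v hvw ((hv v hvw).1 h), h3, fun v h => ?_⟩
    by_cases hvw : v = w
    · exact hvw ▸ .refl
    · exact h4 v ((hv v hvw).1 h)

theorem treeCountOn_erase_of_src_eq [Fintype E] {src tgt : E → V} {S : Finset E} {w : V} {e : E}
    (he : src e = w) : treeCountOn src tgt (S.erase e) w = treeCountOn src tgt S w := by
  simp only [treeCountOn, isArborescenceOn_erase_of_src_eq he]

theorem isArborescenceOn_erase_iff {src tgt : E → V} {S T : Finset E} {w : V} {e e' : E}
    (he' : e' ∈ S) (hne : e' ≠ e) (hs : src e' = src e) :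
    IsArborescenceOn src tgt (S.erase e) T w ↔ IsArborescenceOn src tgt S T w ∧ e ∉ T := by
  have hv : ∀ v, (∃ x ∈ S.erase e, src x = v) ↔ ∃ x ∈ S, src x = v := by
    intro v
    refine ⟨fun ⟨x, hx, h⟩ => ⟨x, Finset.mem_of_mem_erase hx, h⟩, fun ⟨x, hx, h⟩ => ?_⟩
    by_cases hxe : x = e
    · exact ⟨e', Finset.mem_erase.2 ⟨hne, he'⟩, by rw [hs, ← hxe, h]⟩
    · exact ⟨x, Finset.mem_erase.2 ⟨hxe, hx⟩, h⟩
  simp only [IsArborescenceOn, hv, Finset.subset_erase]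
  tauto

/-- Every arborescence uses exactly one of the edges leaving `u ≠ w`. -/
theorem sum_treeCountOn_erase [Fintype E] {src tgt : E → V} {S : Finset E} {u w : V}
    (huw : u ≠ w) (h2 : 1 < (S.filter (src · = u)).card) :
    ∑ e ∈ S.filter (src · = u), treeCountOn src tgt (S.erase e) w =
      ((S.filter (src · = u)).card - 1) * treeCountOn src tgt S w := by
  have key : ∀ e ∈ S.filter (src · = u), treeCountOn src tgt (S.erase e) w =
      ∑ T ∈ Finset.univ.filter (fun T => IsArborescenceOn src tgt S T w),
        if e ∉ T then 1 else 0 := by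
    intro e he
    obtain ⟨e', he', hne⟩ := Finset.exists_mem_ne h2 e
    rw [Finset.mem_filter] at he he'
    rw [← Finset.card_filter, Finset.filter_filter, treeCountOn]
    congr 1
    ext T
    simp only [Finset.mem_filter, Finset.mem_univ, true_and]
    exact isArborescenceOn_erase_iff he'.1 hne (he'.2.trans he.2.symm)
  rw [Finset.sum_congr rfl key, Finset.sum_comm, treeCountOn, mul_comm, ← smul_eq_mul,
    ← Finset.sum_const]
  refine Finset.sum_congr rfl fun T hT => ?_
  obtain ⟨hTS, hT1, -, -⟩ := (Finset.mem_filter.1 hT).2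
  obtain ⟨x, hx⟩ := Finset.card_pos.1 (zero_lt_one.trans h2)
  rw [Finset.mem_filter] at hx
  obtain ⟨t, ⟨ht, htu⟩, huniq⟩ := hT1 u huw ⟨x, hx⟩
  rw [← Finset.card_filter, ← Finset.card_erase_of_mem (Finset.mem_filter.2 ⟨hTS ht, htu⟩)]
  congr 1
  ext e
  simp only [Finset.mem_filter, Finset.mem_erase]
  constructor
  · rintro ⟨⟨h, h'⟩, h''⟩
    exact ⟨fun h => h'' (h ▸ ht), h, h'⟩
  · rintro ⟨h, h', h''⟩
    exact ⟨⟨h', h''⟩, fun h3 => h (huniq e ⟨h3, h''⟩)⟩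

/-- Deleting a source vertex `src e ≠ w` whose only edge is `e` does not change the number of
arborescences. -/
theorem treeCountOn_erase_of_isSource [Fintype E] {src tgt : E → V} {S : Finset E} {w : V} {e : E}
    (he : e ∈ S) (hew : src e ≠ w) (hout : ∀ x ∈ S, src x = src e → x = e)
    (hin : ∀ x ∈ S, tgt x ≠ src e) (htgt : tgt e ≠ w → ∃ x ∈ S, src x = tgt e) :
    treeCountOn src tgt (S.erase e) w = treeCountOn src tgt S w := by
  have mem_of : ∀ T, IsArborescenceOn src tgt S T w → e ∈ T := by
    rintro T ⟨h1, h2, -, -⟩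
    obtain ⟨t, ⟨ht, hte⟩, -⟩ := h2 _ hew ⟨e, he, rfl⟩
    exact hout t (h1 ht) hte ▸ ht
  refine Finset.card_bij' (fun T _ => insert e T) (fun T _ => T.erase e) ?_ ?_ ?_ ?_
  · intro T hT
    obtain ⟨h1, h2, h3, h4⟩ := (Finset.mem_filter.1 hT).2
    have hmono : ∀ a, Relation.ReflTransGen (fun a b => ∃ e ∈ T, src e = a ∧ tgt e = b) a w →
        Relation.ReflTransGen (fun a b => ∃ x ∈ insert e T, src x = a ∧ tgt x = b) a w :=
      fun a h => Relation.ReflTransGen.mono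
        (fun _ _ ⟨x, hx, h⟩ => ⟨x, Finset.mem_insert_of_mem hx, h⟩) _ _ h
    refine Finset.mem_filter.2 ⟨Finset.mem_univ _, ?_, ?_, ?_, ?_⟩
    · exact Finset.insert_subset he (h1.trans (Finset.erase_subset _ _))
    · rintro v hvw ⟨x, hx, hxv⟩
      by_cases hve : v = src e
      · refine ⟨e, ⟨Finset.mem_insert_self _ _, hve.symm⟩, ?_⟩
        rintro y ⟨hy, hyv⟩
        rcases Finset.mem_insert.1 hy with h | h
        · exact h
        · exact hout y (Finset.mem_of_mem_erase (h1 h)) (hyv.trans hve)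
      · obtain ⟨t, ⟨ht, htv⟩, hu⟩ := h2 v hvw
          ⟨x, Finset.mem_erase.2 ⟨by rintro rfl; exact hve hxv.symm, hx⟩, hxv⟩
        refine ⟨t, ⟨Finset.mem_insert_of_mem ht, htv⟩, ?_⟩
        rintro y ⟨hy, hyv⟩
        rcases Finset.mem_insert.1 hy with h | h
        · exact absurd (h ▸ hyv).symm hve
        · exact hu y ⟨h, hyv⟩
    · intro x hx
      rcases Finset.mem_insert.1 hx with h | h
      · exact h ▸ hew
      · exact h3 x h
    · rintro v ⟨x, hx, hxv⟩
      by_cases hxe : x = e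
      · subst hxe hxv
        refine .head ⟨x, Finset.mem_insert_self _ _, rfl, rfl⟩ ?_
        by_cases htw : tgt x = w
        · rw [htw]
        · obtain ⟨y, hy, hyx⟩ := htgt htw
          refine hmono _ (h4 _ ⟨y, Finset.mem_erase.2 ⟨?_, hy⟩, hyx⟩)
          rintro rfl
          exact hin _ he hyx.symm
      · exact hmono _ (h4 _ ⟨x, Finset.mem_erase.2 ⟨hxe, hx⟩, hxv⟩)
  · intro T hT
    obtain ⟨h1, h2, h3, h4⟩ := (Finset.mem_filter.1 hT).2
    have hne : ∀ x ∈ S.erase e, src x ≠ src e := fun x hx h =>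
      (Finset.mem_erase.1 hx).1 (hout x (Finset.mem_erase.1 hx).2 h)
    refine Finset.mem_filter.2 ⟨Finset.mem_univ _, Finset.erase_subset_erase _ h1, ?_,
      fun x hx => h3 x (Finset.mem_of_mem_erase hx), ?_⟩
    · rintro v hvw ⟨x, hx, hxv⟩
      obtain ⟨t, ⟨ht, htv⟩, hu⟩ := h2 v hvw ⟨x, Finset.mem_of_mem_erase hx, hxv⟩
      refine ⟨t, ⟨Finset.mem_erase.2 ⟨?_, ht⟩, htv⟩,
        fun y hy => hu y ⟨Finset.mem_of_mem_erase hy.1, hy.2⟩⟩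
      rintro rfl
      exact hne x hx (hxv.trans htv.symm)
    · rintro v ⟨x, hx, hxv⟩
      have hve : v ≠ src e := hxv ▸ hne x hx
      have hpath := h4 v ⟨x, Finset.mem_of_mem_erase hx, hxv⟩
      clear hxv hx x
      induction hpath using Relation.ReflTransGen.head_induction_on with
      | refl => exact .refl
      | head hstep _ ih =>
        obtain ⟨y, hy, rfl, rfl⟩ := hstep
        refine .head ⟨y, Finset.mem_erase.2 ⟨?_, hy⟩, rfl, rfl⟩ (ih (hin y (h1 hy)))
        rintro rfl
        exact hve rfl
  · intro T hT
    have h1 := (Finset.mem_filter.1 hT).2.1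
    exact Finset.erase_insert fun h => by simpa using h1 h
  · intro T hT
    exact Finset.insert_erase (mem_of T (Finset.mem_filter.1 hT).2)

theorem treeCountOn_empty [Fintype E] (src tgt : E → V) (w : V) :
    treeCountOn src tgt ∅ w = 1 := by
  rw [treeCountOn, Finset.card_eq_one]
  refine ⟨∅, ?_⟩
  ext T
  simp only [Finset.mem_filter, Finset.mem_univ, true_and, Finset.mem_singleton]
  constructor
  · exact fun h => Finset.subset_empty.1 h.1
  · rintro rfl
    simp [IsArborescenceOn]

theorem card_eulerTrail_empty (src tgt : E → V) (w : V) :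
    Nat.card (EulerTrail src tgt ∅ w w) = 1 := by
  rw [Nat.card_eq_one_iff_unique]
  refine ⟨⟨?_⟩, ⟨⟨[], rfl, List.nodup_nil, by simp⟩⟩⟩
  rintro ⟨a, -, -, ha⟩ ⟨b, -, -, hb⟩
  have a_nil : a = [] := List.eq_nil_iff_forall_not_mem.2 fun x hx => by simpa using (ha x).1 hx
  have b_nil : b = [] := List.eq_nil_iff_forall_not_mem.2 fun x hx => by simpa using (hb x).1 hx
  simp [a_nil, b_nil]

theorem treeCountOn_eq_zero [Fintype E] {src tgt : E → V} {S : Finset E} {w : V}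
    (hS : S.Nonempty) (hout : ∀ e ∈ S, src e ≠ w) (hin : ∀ e ∈ S, tgt e ≠ w) :
    treeCountOn src tgt S w = 0 := by
  rw [treeCountOn, Finset.card_eq_zero, Finset.filter_eq_empty_iff]
  rintro T - ⟨h1, -, -, h4⟩
  obtain ⟨e, he⟩ := hS
  rcases Relation.ReflTransGen.cases_tail (h4 _ ⟨e, he, rfl⟩) with h | ⟨_, -, x, hx, -, hxw⟩
  · exact hout e he h.symm
  · exact hin x (h1 hx) hxw

/-- The BEST formula for Eulerian trails from `u` to `w`. -/
theorem card_eulerTrail_eq [Fintype V] [Fintype E] (src tgt : E → V) (w : V) (S : Finset E) (u : V)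
    (hbal : ∀ v, (S.filter (src · = v)).card + (if v = w then 1 else 0) =
      (S.filter (tgt · = v)).card + (if v = u then 1 else 0)) :
    Nat.card (EulerTrail src tgt S u w) =
      treeCountOn src tgt S w * ((S.filter (src · = w)).card.factorial *
        ∏ v ∈ Finset.univ.erase w, ((S.filter (src · = v)).card - 1).factorial) := by
  induction hn : S.card generalizing S u with
  | zero =>
    obtain rfl := Finset.card_eq_zero.1 hn
    have huw : u = w := by
      have := hbal u
      by_contra h
      simp [h] at this
    subst huw
    simp [card_eulerTrail_empty, treeCountOn_empty]
  | succ n ih =>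
    have hS : S.Nonempty := Finset.card_pos.1 (by omega)
    have hrec : ∀ e ∈ S.filter (src · = u), Nat.card (EulerTrail src tgt (S.erase e) (tgt e) w) =
        treeCountOn src tgt (S.erase e) w * (((S.erase e).filter (src · = w)).card.factorial *
        ∏ v ∈ Finset.univ.erase w, (((S.erase e).filter (src · = v)).card - 1).factorial) := by
      intro e he
      rw [Finset.mem_filter] at he
      refine ih _ _ (fun v => ?_) (by rw [Finset.card_erase_of_mem he.1, hn]; rfl)
      have h1 := card_filter_erase_add (src · = v) S he.1
      have h2 := card_filter_erase_add (tgt · = v) S he.1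
      have h3 := hbal v
      have h4 : (if src e = v then 1 else 0) = (if v = u then 1 else 0) := by
        simp [he.2, eq_comm]
      have h5 : (if tgt e = v then 1 else 0) = (if v = tgt e then 1 else 0) := by
        simp [eq_comm]
      simp only [h4, h5] at h1 h2
      omega
    have hother : ∀ e ∈ S.filter (src · = u), ∀ v, v ≠ u →
        ((S.erase e).filter (src · = v)).card = (S.filter (src · = v)).card := by
      intro e he v hv
      rw [Finset.mem_filter] at he
      have h1 := card_filter_erase_add (src · = v) S he.1
      simpa [he.2, hv.symm] using h1
    have hself : ∀ e ∈ S.filter (src · = u),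
        ((S.erase e).filter (src · = u)).card = (S.filter (src · = u)).card - 1 := by
      intro e he
      rw [Finset.mem_filter] at he
      have h1 := card_filter_erase_add (src · = u) S he.1
      simp only [he.2, if_true] at h1
      omega
    rw [card_eulerTrail src tgt S u w hS, Finset.sum_congr rfl hrec]
    by_cases huw : u = w
    · subst huw
      have hio : (S.filter (src · = u)).card = (S.filter (tgt · = u)).card := by
        simpa using hbal u
      rcases Nat.eq_zero_or_pos (S.filter (src · = u)).card with hd | hd
      · rw [treeCountOn_eq_zero hS (Finset.filter_eq_empty_iff.1 (Finset.card_eq_zero.1 hd))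
          (Finset.filter_eq_empty_iff.1 (Finset.card_eq_zero.1 (hio ▸ hd))),
          Finset.card_eq_zero.1 hd]
        simp
      have hterm : ∀ e ∈ S.filter (src · = u),
          treeCountOn src tgt (S.erase e) u *
            (((S.erase e).filter (src · = u)).card.factorial *
            ∏ v ∈ Finset.univ.erase u, (((S.erase e).filter (src · = v)).card - 1).factorial) =
          treeCountOn src tgt S u * (((S.filter (src · = u)).card - 1).factorial *
            ∏ v ∈ Finset.univ.erase u, ((S.filter (src · = v)).card - 1).factorial) := by
        intro e he
        rw [hself e he, treeCountOn_erase_of_src_eq (Finset.mem_filter.1 he).2]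
        congr 2
        exact Finset.prod_congr rfl fun v hv => by rw [hother e he v (Finset.ne_of_mem_erase hv)]
      rw [Finset.sum_congr rfl hterm, Finset.sum_const, smul_eq_mul,
        ← Nat.mul_factorial_pred hd.ne']
      ring
    · have hio : (S.filter (src · = u)).card = (S.filter (tgt · = u)).card + 1 := by
        simpa [huw] using hbal u
      have hu : u ∈ Finset.univ.erase w := Finset.mem_erase.2 ⟨huw, Finset.mem_univ u⟩
      have hterm : ∀ e ∈ S.filter (src · = u),
          treeCountOn src tgt (S.erase e) w *
            (((S.erase e).filter (src · = w)).card.factorial *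
            ∏ v ∈ Finset.univ.erase w, (((S.erase e).filter (src · = v)).card - 1).factorial) =
          treeCountOn src tgt (S.erase e) w * ((S.filter (src · = w)).card.factorial *
            (((S.filter (src · = u)).card - 1 - 1).factorial *
            ∏ v ∈ (Finset.univ.erase w).erase u,
              ((S.filter (src · = v)).card - 1).factorial)) := by
        intro e he
        rw [hother e he w (Ne.symm huw), ← Finset.mul_prod_erase _ _ hu, hself e he]
        congr 3
        exact Finset.prod_congr rfl fun v hv => by rw [hother e he v (Finset.ne_of_mem_erase hv)]
      rw [Finset.sum_congr rfl hterm, ← Finset.sum_mul, ← Finset.mul_prod_erase _ _ hu]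
      rcases Nat.lt_or_ge 1 (S.filter (src · = u)).card with hd | hd
      · rw [sum_treeCountOn_erase huw hd,
          ← Nat.mul_factorial_pred (Nat.sub_ne_zero_of_lt hd)]
        ring
      · have hd1 : (S.filter (src · = u)).card = 1 := by omega
        obtain ⟨e, he⟩ := Finset.card_eq_one.1 hd1
        have heS := Finset.mem_filter.1 (he ▸ Finset.mem_singleton_self e)
        have hin : ∀ x ∈ S, tgt x ≠ u :=
          Finset.filter_eq_empty_iff.1 (Finset.card_eq_zero.1 (by omega))
        have htree : treeCountOn src tgt (S.erase e) w = treeCountOn src tgt S w := by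
          refine treeCountOn_erase_of_isSource heS.1 (heS.2 ▸ huw) (fun x hx hxe => ?_)
            (heS.2 ▸ hin) fun htw => ?_
          · exact Finset.mem_singleton.1 (he ▸ Finset.mem_filter.2 ⟨hx, hxe.trans heS.2⟩)
          · have hpos : 0 < (S.filter (tgt · = tgt e)).card :=
              Finset.card_pos.2 ⟨e, Finset.mem_filter.2 ⟨heS.1, rfl⟩⟩
            have hb := hbal (tgt e)
            simp only [htw, if_false] at hb
            obtain ⟨x, hx⟩ := Finset.card_pos.1
              (show 0 < (S.filter (src · = tgt e)).card by omega)
            exact ⟨x, Finset.mem_filter.1 hx⟩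
        rw [hd1, he, Finset.sum_singleton, htree]

theorem isEdgeWalk_cons_iff {src tgt : E → V} {u w : V} {e : E} {l : List E} :
    IsEdgeWalk src tgt u (e :: l) w ↔ src e = u ∧
      (e :: l).IsChain (fun a b => tgt a = src b) ∧ tgt ((e :: l).getLast (by simp)) = w := by
  induction l generalizing u e with
  | nil => simp [IsEdgeWalk]
  | cons x l ih =>
    rw [IsEdgeWalk, ih, List.isChain_cons_cons, List.getLast_cons (List.cons_ne_nil _ _)]
    grind

theorem isEdgeWalk_closed_iff {src tgt : E → V} {e : E} {l : List E} :
    IsEdgeWalk src tgt (tgt e) l (src e) ↔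
      ∀ i (hi : i < (e :: l).length), tgt (e :: l)[i] =
        src ((e :: l)[(i + 1) % (e :: l).length]'(Nat.mod_lt _ (by simp))) := by
  have h : IsEdgeWalk src tgt (tgt e) l (src e) ↔ IsEdgeWalk src tgt (src e) (e :: l) (src e) :=
    by simp [IsEdgeWalk]
  rw [h, isEdgeWalk_cons_iff, List.isChain_iff_getElem, List.getLast_eq_getElem]
  constructor
  · rintro ⟨-, h1, h2⟩ i hi
    rcases Nat.lt_or_ge (i + 1) (e :: l).length with hlt | hge
    · simp only [Nat.mod_eq_of_lt hlt]
      exact h1 i hlt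
    · have hil : i + 1 = (e :: l).length := by omega
      simp only [hil, Nat.mod_self]
      simp only [← hil] at h2
      simpa using h2
  · intro h1
    refine ⟨rfl, fun i hi => ?_, ?_⟩
    · have := h1 i (by omega)
      simpa only [Nat.mod_eq_of_lt hi] using this
    · have := h1 ((e :: l).length - 1) (by simp)
      simpa using this

/-- Eulerian cycles, as cyclic enumerations of the edges, starting with the edge `e0`. -/
abbrev EulerCycle [Fintype E] (src tgt : E → V) (e0 : E) : Type _ :=
  {e : Fin (Fintype.card E) ≃ E //
    (∀ i : Fin (Fintype.card E), tgt (e i) =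
      src (e ⟨(i.val + 1) % Fintype.card E, Nat.mod_lt _ i.pos⟩)) ∧
    e ⟨0, Fintype.card_pos_iff.mpr ⟨e0⟩⟩ = e0}

theorem ofFn_eulerCycle [Fintype E] {src tgt : E → V} {e0 : E} (c : EulerCycle src tgt e0) :
    e0 :: (List.ofFn c.1).tail = List.ofFn c.1 := by
  have hpos : 0 < Fintype.card E := Fintype.card_pos_iff.mpr ⟨e0⟩
  have hne : List.ofFn c.1 ≠ [] := by simpa using hpos.ne'
  conv_rhs => rw [← List.cons_head_tail hne]
  congr 1
  rw [List.head_eq_getElem, List.getElem_ofFn]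
  exact c.2.2.symm

/-- An Eulerian cycle starting with `e0` is a closed trail through the remaining edges. -/
def eulerCycleToTrail [Fintype E] (src tgt : E → V) (e0 : E) (c : EulerCycle src tgt e0) :
    EulerTrail src tgt (Finset.univ.erase e0) (tgt e0) (src e0) :=
  ⟨(List.ofFn c.1).tail, by
    have hL := ofFn_eulerCycle c
    have hnd : (e0 :: (List.ofFn c.1).tail).Nodup := hL ▸ List.nodup_ofFn.2 c.1.injective
    refine ⟨isEdgeWalk_closed_iff.2 ?_, (List.nodup_cons.1 hnd).2, fun x => ?_⟩
    · simp only [hL, List.length_ofFn, List.getElem_ofFn]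
      exact fun i hi => c.2.1 ⟨i, hi⟩
    · have hx : x ∈ e0 :: (List.ofFn c.1).tail := by
        rw [hL, List.mem_ofFn]
        exact c.1.surjective x
      have hn := (List.nodup_cons.1 hnd).1
      simp only [List.mem_cons] at hx
      simp only [Finset.mem_erase, Finset.mem_univ, and_true]
      grind⟩

theorem eulerCycleToTrail_bijective [Fintype E] (src tgt : E → V) (e0 : E) :
    Function.Bijective (eulerCycleToTrail src tgt e0) := by
  constructor
  · intro c c' h
    have h' : (List.ofFn c.1).tail = (List.ofFn c'.1).tail := congrArg Subtype.val h
    have h'' := ofFn_eulerCycle c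
    rw [h', ofFn_eulerCycle c'] at h''
    exact Subtype.ext (DFunLike.coe_injective (List.ofFn_injective h''.symm))
  · rintro ⟨l, hw, hnd, hmem⟩
    have hnd' : (e0 :: l).Nodup := List.nodup_cons.2 ⟨by simp [hmem], hnd⟩
    have hmem' : ∀ x, x ∈ e0 :: l := fun x => by
      simp only [List.mem_cons, hmem, Finset.mem_erase, Finset.mem_univ, and_true]
      exact em _
    have hlen : Fintype.card E = (e0 :: l).length := by
      simpa using (Fintype.card_congr (hnd'.getEquivOfForallMemList _ hmem')).symm
    let c : Fin (Fintype.card E) ≃ E :=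
      (finCongr hlen).trans (hnd'.getEquivOfForallMemList _ hmem')
    have hc : ∀ i (hi : i < Fintype.card E), c ⟨i, hi⟩ = (e0 :: l)[i]'(hlen ▸ hi) :=
      fun i hi => rfl
    refine ⟨⟨c, fun i => ?_, hc _ _⟩, Subtype.ext ?_⟩
    · rw [hc, show i = ⟨i.1, i.2⟩ from rfl, hc]
      simp only [hlen]
      exact isEdgeWalk_closed_iff.1 hw i (hlen ▸ i.2)
    · have hL : List.ofFn c = e0 :: l :=
        List.ext_getElem (by rw [List.length_ofFn, hlen]) fun i h1 h2 => by
          rw [List.getElem_ofFn, hc]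
      change (List.ofFn c).tail = l
      rw [hL, List.tail_cons]

theorem card_eulerCycle_le [Fintype E] (src tgt : E → V) (e0 e1 : E) :
    Nat.card (EulerCycle src tgt e0) ≤ Nat.card (EulerCycle src tgt e1) := by
  have hpos : 0 < Fintype.card E := Fintype.card_pos_iff.mpr ⟨e0⟩
  have : NeZero (Fintype.card E) := ⟨hpos.ne'⟩
  have hsucc : ∀ i : Fin (Fintype.card E),
      (⟨(i.val + 1) % Fintype.card E, Nat.mod_lt _ i.pos⟩ : Fin (Fintype.card E)) = i + 1 := by
    intro i
    ext
    simp [Fin.val_add]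
  have hzero : (⟨0, hpos⟩ : Fin (Fintype.card E)) = 0 := rfl
  refine Nat.card_le_card_of_injective
    (fun c => ⟨(Equiv.addRight (c.1.symm e1)).trans c.1, fun i => ?_, ?_⟩) ?_
  · have := c.2.1 (i + c.1.symm e1)
    simp only [hsucc] at this ⊢
    simpa [add_right_comm] using this
  · simp [hzero]
  · intro c c' h
    have h1 : ∀ i, c.1 (i + c.1.symm e1) = c'.1 (i + c'.1.symm e1) :=
      fun i => DFunLike.congr_fun (congrArg Subtype.val h) i
    have h2 : c.1.symm e1 = c'.1.symm e1 := by
      have h3 := h1 (-c.1.symm e1)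
      rw [neg_add_cancel] at h3
      have h4 := h3.symm.trans (c.2.2.trans c'.2.2.symm)
      have h5 := c'.1.injective h4
      exact neg_add_eq_zero.1 (h5.trans hzero)
    refine Subtype.ext (Equiv.ext fun i => ?_)
    have h3 := h1 (i - c.1.symm e1)
    rwa [← h2, sub_add_cancel] at h3

theorem isArborescenceOn_univ_iff [Fintype E] {src tgt : E → V} {T : Finset E} {w : V}
    (hpos : ∀ v, ∃ e, src e = v) :
    IsArborescenceOn src tgt Finset.univ T w ↔ IsArborescence src tgt T w := by
  simp [IsArborescenceOn, IsArborescence, hpos]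

theorem exists_src_eq_of_connected [Fintype E] {src tgt : E → V} (e0 : E)
    (hconn : ∀ u v : V, Relation.EqvGen
      (fun a b => ∃ e, (src e = a ∧ tgt e = b) ∨ (src e = b ∧ tgt e = a)) u v)
    (hbal : ∀ v, outdeg src tgt v = indeg src tgt v) (v : V) : ∃ e, src e = v := by
  have htgt : ∀ e, ∃ e', src e' = tgt e := by
    intro e
    have h : 0 < indeg src tgt (tgt e) := Finset.card_pos.2 ⟨e, by simp⟩
    rw [← hbal] at h
    obtain ⟨e', he'⟩ := Finset.card_pos.1 h
    exact ⟨e', (Finset.mem_filter.1 he').2⟩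
  have key : ∀ a b, Relation.EqvGen
      (fun a b => ∃ e, (src e = a ∧ tgt e = b) ∨ (src e = b ∧ tgt e = a)) a b →
      ((∃ e, src e = a) ↔ ∃ e, src e = b) := by
    intro a b h
    induction h with
    | rel a b h =>
      obtain ⟨e, ⟨rfl, rfl⟩ | ⟨rfl, rfl⟩⟩ := h
      · exact ⟨fun _ => htgt e, fun _ => ⟨e, rfl⟩⟩
      · exact ⟨fun _ => ⟨e, rfl⟩, fun _ => htgt e⟩
    | refl => exact Iff.rfl
    | symm _ _ _ ih => exact ih.symm
    | trans _ _ _ _ _ ih1 ih2 => exact ih1.trans ih2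
  exact (key _ _ (hconn (src e0) v)).1 ⟨e0, rfl⟩

theorem card_eulerCycle_eq [Fintype V] [Fintype E] (src tgt : E → V) (e0 : E)
    (hpos : ∀ v, ∃ e, src e = v) (hbal : ∀ v, outdeg src tgt v = indeg src tgt v) :
    Nat.card (EulerCycle src tgt e0) =
      treeCount src tgt (src e0) * ∏ v, (outdeg src tgt v - 1).factorial := by
  have hsrc : ∀ v, ((Finset.univ.erase e0).filter (src · = v)).card +
      (if src e0 = v then 1 else 0) = outdeg src tgt v :=
    fun v => card_filter_erase_add _ _ (Finset.mem_univ e0)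
  have htgt : ∀ v, ((Finset.univ.erase e0).filter (tgt · = v)).card +
      (if tgt e0 = v then 1 else 0) = indeg src tgt v :=
    fun v => card_filter_erase_add _ _ (Finset.mem_univ e0)
  have htree : treeCountOn src tgt (Finset.univ.erase e0) (src e0) =
      treeCount src tgt (src e0) := by
    rw [treeCountOn_erase_of_src_eq rfl, treeCountOn, treeCount, Nat.card_eq_fintype_card,
      Fintype.card_subtype]
    simp only [isArborescenceOn_univ_iff hpos]
  rw [Nat.card_congr (Equiv.ofBijective _ (eulerCycleToTrail_bijective src tgt e0)),
    card_eulerTrail_eq, htree, ← Finset.mul_prod_erase _ _ (Finset.mem_univ (src e0))]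
  · congr 2
    · rw [← hsrc, if_pos rfl, Nat.add_sub_cancel]
    · refine Finset.prod_congr rfl fun v hv => ?_
      rw [← hsrc v, if_neg (Finset.ne_of_mem_erase hv).symm, Nat.add_zero]
  · intro v
    rw [eq_comm (a := v) (b := src e0), eq_comm (a := v) (b := tgt e0), hsrc, htgt, hbal]

end BEST

/-- BEST theorem: for a connected directed multigraph in which every vertex is
balanced, the number of Eulerian cycles starting with a marked edge `e0` equals
`T(G, w0) ∏_v (outdeg v - 1)!`; in particular `T(G, w0)` does not depend on `w0`. -/
theorem stmt13 {V E : Type*} [Fintype V] [Fintype E] (src tgt : E → V) (e0 : E) (w0 : V)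
    (hconn : ∀ u v : V, Relation.EqvGen
      (fun a b => ∃ e, (src e = a ∧ tgt e = b) ∨ (src e = b ∧ tgt e = a)) u v)
    (hbal : ∀ v, outdeg src tgt v = indeg src tgt v) :
    Nat.card {e : Fin (Fintype.card E) ≃ E //
        (∀ i : Fin (Fintype.card E), tgt (e i) =
          src (e ⟨(i.val + 1) % Fintype.card E, Nat.mod_lt _ i.pos⟩)) ∧
        e ⟨0, Fintype.card_pos_iff.mpr ⟨e0⟩⟩ = e0} =
      treeCount src tgt w0 * ∏ v, (outdeg src tgt v - 1).factorial ∧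
    ∀ w1 : V, treeCount src tgt w0 = treeCount src tgt w1 := by
  have hpos := exists_src_eq_of_connected e0 hconn hbal
  have hcount : ∀ w, Nat.card (EulerCycle src tgt e0) =
      treeCount src tgt w * ∏ v, (outdeg src tgt v - 1).factorial := by
    intro w
    obtain ⟨e1, rfl⟩ := hpos w
    rw [← card_eulerCycle_eq src tgt e1 hpos hbal]
    exact (card_eulerCycle_le src tgt e0 e1).antisymm (card_eulerCycle_le src tgt e1 e0)
  refine ⟨hcount w0, fun w1 => ?_⟩
  exact Nat.eq_of_mul_eq_mul_right (Finset.prod_pos fun v _ => Nat.factorial_pos _)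
    ((hcount w0).symm.trans (hcount w1))
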